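/- Let ξ ∈ ℝ and let n ∈ {1,2,3}. There exists a constant κ > 0 depending only on ξ such that for any C = (C₀,C₁) ∈ ℤ² and any x ∈ ℤ^{n+1}, the point y = C₁x⁻ − C₀x⁺ ∈ ℤⁿ satisfies ‖y‖ ≤ κ(‖x‖L(C) + ‖C‖L(x)) and L(y) ≤ κ‖C‖L(x). -/

import Mathlib

noncomputable section

/-- Sup norm of a vector. -/
def vnormG {n : ℕ} (x : Fin n → ℝ) : ℝ := ⨆ i, |x i|

/-- L(x) = max_{1≤i≤n} |x₀ξⁱ − x_i| for x ∈ ℝ^{n+1}. -/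
def LG (ξ : ℝ) {n : ℕ} (x : Fin (n + 1) → ℝ) : ℝ :=
  ⨆ i : Fin n, |x 0 * ξ ^ ((i : ℕ) + 1) - x i.succ|

theorem abs_le_vnormG {n : ℕ} (x : Fin n → ℝ) (i : Fin n) : |x i| ≤ vnormG x :=
  le_ciSup (f := fun i => |x i|) (Set.finite_range _).bddAbove i

theorem LG_nonneg (ξ : ℝ) {n : ℕ} (x : Fin (n + 1) → ℝ) : 0 ≤ LG ξ x :=
  Real.iSup_nonneg fun _ => abs_nonneg _

theorem abs_sub_le_LG (ξ : ℝ) {n : ℕ} (x : Fin (n + 1) → ℝ) (k : Fin (n + 1)) :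
    |x 0 * ξ ^ (k : ℕ) - x k| ≤ LG ξ x := by
  induction k using Fin.cases with
  | zero => simpa using LG_nonneg ξ x
  | succ i =>
    simpa [LG] using le_ciSup (f := fun i : Fin n => |x 0 * ξ ^ ((i : ℕ) + 1) - x i.succ|)
      (Set.finite_range _).bddAbove i

/-- Statement 4, with n = m + 1 ∈ {1,2,3} (so m ≤ 2): for C ∈ ℤ² and x ∈ ℤ^{n+1},
the point y = C₁x⁻ − C₀x⁺ ∈ ℤⁿ satisfies ‖y‖ ≤ κ(‖x‖L(C) + ‖C‖L(x)) and
L(y) ≤ κ‖C‖L(x). -/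
theorem statement4 (ξ : ℝ) (m : ℕ) (hm : m ≤ 2) :
    ∃ κ : ℝ, 0 < κ ∧
      ∀ (C : Fin 2 → ℤ) (x : Fin (m + 2) → ℤ),
        vnormG (fun k : Fin (m + 1) =>
            (C 1 : ℝ) * (x k.castSucc : ℝ) - (C 0 : ℝ) * (x k.succ : ℝ))
          ≤ κ * (vnormG (fun k : Fin (m + 2) => (x k : ℝ)) * |(C 0 : ℝ) * ξ - (C 1 : ℝ)|
              + max |(C 0 : ℝ)| |(C 1 : ℝ)| * LG ξ (fun k : Fin (m + 2) => (x k : ℝ))) ∧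
        LG ξ (fun k : Fin (m + 1) =>
            (C 1 : ℝ) * (x k.castSucc : ℝ) - (C 0 : ℝ) * (x k.succ : ℝ))
          ≤ κ * (max |(C 0 : ℝ)| |(C 1 : ℝ)| * LG ξ (fun k : Fin (m + 2) => (x k : ℝ))) := by
  have hξ := abs_nonneg ξ
  have hpow : 0 ≤ (1 + |ξ|) ^ m := by positivity
  refine ⟨2 + |ξ| + (1 + |ξ|) ^ m, by positivity, fun C x => ?_⟩
  set X : Fin (m + 2) → ℝ := fun k => (x k : ℝ)
  set M := max |(C 0 : ℝ)| |(C 1 : ℝ)|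
  set L := LG ξ X
  have hL : 0 ≤ L := LG_nonneg ξ X
  have hC₀ : |(C 0 : ℝ)| ≤ M := le_max_left _ _
  have hC₁ : |(C 1 : ℝ)| ≤ M := le_max_right _ _
  have hM : 0 ≤ M := (abs_nonneg _).trans hC₀
  have hML : 0 ≤ M * L := mul_nonneg hM hL
  have hN : 0 ≤ vnormG X := (abs_nonneg _).trans (abs_le_vnormG X 0)
  have he : ∀ k : Fin (m + 2), |X 0 * ξ ^ (k : ℕ) - X k| ≤ L := abs_sub_le_LG ξ X
  constructor
  · refine Real.iSup_le (fun k => ?_) (by positivity)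
    have hshift : |X k.castSucc * ξ - X k.succ| ≤ (1 + |ξ|) * L := by
      have h₀ := he k.castSucc
      have h₁ := he k.succ
      rw [Fin.val_castSucc] at h₀
      rw [Fin.val_succ] at h₁
      calc |X k.castSucc * ξ - X k.succ|
          = |(X 0 * ξ ^ ((k : ℕ) + 1) - X k.succ)
              - (X 0 * ξ ^ (k : ℕ) - X k.castSucc) * ξ| := by congr 1; ring
        _ ≤ L + L * |ξ| := by
            refine (abs_sub _ _).trans ?_
            rw [abs_mul]
            gcongr
        _ = (1 + |ξ|) * L := by ring
    calc |(C 1 : ℝ) * X k.castSucc - (C 0 : ℝ) * X k.succ|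
        = |(C 0 : ℝ) * (X k.castSucc * ξ - X k.succ)
            - X k.castSucc * ((C 0 : ℝ) * ξ - C 1)| := by congr 1; ring
      _ ≤ M * ((1 + |ξ|) * L) + vnormG X * |(C 0 : ℝ) * ξ - C 1| := by
          refine (abs_sub _ _).trans ?_
          rw [abs_mul, abs_mul]
          gcongr
          exact abs_le_vnormG X _
      _ ≤ _ := by
          have hNC : 0 ≤ vnormG X * |(C 0 : ℝ) * ξ - C 1| := by positivity
          nlinarith [mul_nonneg hpow hML, mul_nonneg hpow hNC, mul_nonneg hξ hNC]
  · refine Real.iSup_le (fun i => ?_) (by positivity)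
    have hξi : |ξ| ^ ((i : ℕ) + 1) ≤ (1 + |ξ|) ^ m :=
      (pow_le_pow_left₀ hξ (by linarith) _).trans
        (pow_le_pow_right₀ (by linarith) i.isLt)
    have h₀ := he i.succ.castSucc
    have h₁ := he 1
    have h₂ := he i.succ.succ
    simp only [Fin.val_castSucc, Fin.val_succ, Fin.val_one, pow_one] at h₀ h₁ h₂
    calc |((C 1 : ℝ) * X 0 - (C 0 : ℝ) * X 1) * ξ ^ ((i : ℕ) + 1)
          - ((C 1 : ℝ) * X i.succ.castSucc - (C 0 : ℝ) * X i.succ.succ)|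
        = |(C 1 : ℝ) * (X 0 * ξ ^ ((i : ℕ) + 1) - X i.succ.castSucc)
            - (C 0 : ℝ) * ((X 0 * ξ ^ ((i : ℕ) + 1 + 1) - X i.succ.succ)
              - (X 0 * ξ - X 1) * ξ ^ ((i : ℕ) + 1))| := by congr 1; ring
      _ ≤ M * L + M * (L + L * (1 + |ξ|) ^ m) := by
          refine (abs_sub _ _).trans ?_
          rw [abs_mul, abs_mul]
          gcongr
          refine (abs_sub _ _).trans ?_
          rw [abs_mul, abs_pow]
          gcongr
      _ ≤ _ := by nlinarith [mul_nonneg hξ hML]
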